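/- Suppose q ∈ C^∞(ℝ) is strictly positive, x(t) = ∫_a^t √(q(u)) du, the inverse t(x) of x(t) exists, and p(x) = 2{t,x} belongs to the Schwartz space S(ℝ) with |p̂(ξ)| ≤ Γ·exp(−μ|ξ|) for all ξ ∈ ℝ, for some positive reals Γ, μ. Then there exists C > 0, depending only on q, a, b, Γ and μ but not on λ, with the following property: for every λ > 2·max{1/μ, Γ} and every pair σ, ν ∈ S(ℝ) satisfying σ = S[T[σ]] + p + ν on ℝ, σ̂ supported in [−√2·λ, √2·λ], |σ̂(ξ)| ≤ (1 + 2Γ/λ)·Γ·exp(−μ|ξ|) for |ξ| ≤ √2·λ, and ‖ν‖_∞ ≤ (Γ/(2μ))·(1 + 4Γ/λ)·exp(−μλ), if one defines δ = T[σ], r(t) = log(q(t)) + δ(x(t)), α(t) = λ·∫_a^t exp(r(u)/2) du, u(t) = cos(α(t))/√(α′(t)) and v(t) = sin(α(t))/√(α′(t)), then there exist twice continuously differentiable solutions ũ, ṽ of y″(t) + λ²q(t)y(t) = 0 on [a,b] forming a basis of the solution space such that |u(t) − ũ(t)| ≤ (C/λ)·exp(−μλ) and |v(t) − ṽ(t)|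 ≤ (C/λ)·exp(−μλ) for all t ∈ [a,b]. -/

import Mathlib

open MeasureTheory Filter

noncomputable section

/-- The Fourier transform `f̂(ξ) = ∫ exp(−i x ξ) f(x) dx` of a real-valued function. -/
def FT (f : ℝ → ℝ) (ξ : ℝ) : ℂ :=
  ∫ x : ℝ, Complex.exp (-(Complex.I * (x:ℂ) * (ξ:ℂ))) * (f x : ℂ)

/-- Convolution of two complex-valued functions on `ℝ`. -/
def conv (f g : ℝ → ℂ) (ξ : ℝ) : ℂ := ∫ η : ℝ, f (ξ - η) * g η

/-- `convIter ψ n = ψ^{*(n+1)}`, the `(n+1)`-fold convolution of `ψ` with itself. -/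
def convIter (ψ : ℝ → ℂ) : ℕ → ℝ → ℂ
  | 0 => ψ
  | n + 1 => conv (convIter ψ n) ψ

/-- `exp₁*[ψ](ξ) = Σ_{n=1}^∞ ψ^{*n}(ξ)/(n!·(2π)^{n−1})`. -/
def exp1star (ψ : ℝ → ℂ) (ξ : ℝ) : ℂ :=
  ∑' n : ℕ, convIter ψ n ξ / ((Nat.factorial (n + 1) : ℂ) * ((2 * Real.pi : ℝ) : ℂ) ^ n)

/-- `exp₂*[ψ](ξ) = Σ_{n=2}^∞ ψ^{*n}(ξ)/(n!·(2π)^{n−1})`. -/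
def exp2star (ψ : ℝ → ℂ) (ξ : ℝ) : ℂ :=
  ∑' n : ℕ, convIter ψ (n + 1) ξ / ((Nat.factorial (n + 2) : ℂ) * ((2 * Real.pi : ℝ) : ℂ) ^ (n + 1))

/-- `W_b[f](ξ) = f(ξ)·b̂(ξ)/(4λ² − ξ²)`. -/
def Wb (lam : ℝ) (b : ℝ → ℝ) (f : ℝ → ℂ) (ξ : ℝ) : ℂ :=
  f ξ * ((b ξ : ℝ) : ℂ) / (((4 * lam ^ 2 - ξ ^ 2 : ℝ)) : ℂ)

/-- `W̃_b[f](ξ) = −iξ·f(ξ)·b̂(ξ)/(4λ² − ξ²)`. -/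
def Wtb (lam : ℝ) (b : ℝ → ℝ) (f : ℝ → ℂ) (ξ : ℝ) : ℂ :=
  -(Complex.I * (ξ:ℂ)) * f ξ * ((b ξ : ℝ) : ℂ) / (((4 * lam ^ 2 - ξ ^ 2 : ℝ)) : ℂ)

/-- The nonlinear operator
`R[f](ξ) = (1/(8π))·(W̃_b[f] * W̃_b[f])(ξ) − 4λ²·exp₂*[W_b[f]](ξ) + w(ξ)`. -/
def Rop (lam : ℝ) (b : ℝ → ℝ) (w : ℝ → ℂ) (f : ℝ → ℂ) (ξ : ℝ) : ℂ :=
  ((1 / (8 * Real.pi) : ℝ) : ℂ) * conv (Wtb lam b f) (Wtb lam b f) ξ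
    - ((4 * lam ^ 2 : ℝ) : ℂ) * exp2star (Wb lam b f) ξ + w ξ

/-- The nonlinear differential operator `S[f](x) = (f′(x))²/4 − 4λ²·(exp(f(x)) − f(x) − 1)`. -/
def Sop (lam : ℝ) (f : ℝ → ℂ) (x : ℝ) : ℂ :=
  (deriv f x) ^ 2 / 4 - ((4 * lam ^ 2 : ℝ) : ℂ) * (Complex.exp (f x) - f x - 1)

/-- The operator `T[f](x) = (1/2π)·∫ exp(i x ξ)·f̂(ξ)/(4λ² − ξ²) dξ`. -/
def OpT (lam : ℝ) (f : ℝ → ℝ) (x : ℝ) : ℂ :=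
  ((1 / (2 * Real.pi) : ℝ) : ℂ) *
    ∫ ξ : ℝ, Complex.exp (Complex.I * (x:ℂ) * (ξ:ℂ)) * FT f ξ / (((4 * lam ^ 2 - ξ ^ 2 : ℝ)) : ℂ)

/-- The band-limited operator `T_b[f](x) = (1/2π)·∫ exp(i x ξ)·f̂(ξ)·b̂(ξ)/(4λ² − ξ²) dξ`,
so that `T_b[f]^(ξ) = f̂(ξ)·b̂(ξ)/(4λ² − ξ²)`. -/
def Tb (lam : ℝ) (b : ℝ → ℝ) (f : ℝ → ℝ) (x : ℝ) : ℂ :=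
  ((1 / (2 * Real.pi) : ℝ) : ℂ) *
    ∫ ξ : ℝ, Complex.exp (Complex.I * (x:ℂ) * (ξ:ℂ)) * FT f ξ * ((b ξ : ℝ) : ℂ) /
      (((4 * lam ^ 2 - ξ ^ 2 : ℝ)) : ℂ)

/-- The Schwarzian derivative `{f, x} = f′′′(x)/f′(x) − (3/2)·(f′′(x)/f′(x))²`. -/
def schwarzian (f : ℝ → ℝ) (x : ℝ) : ℝ :=
  deriv (deriv (deriv f)) x / deriv f x - (3 / 2) * (deriv (deriv f) x / deriv f x) ^ 2

/-- A real-valued function is Schwartz if it agrees with an element of the Schwartz space. -/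
def IsSchwartz (f : ℝ → ℝ) : Prop := ∃ g : SchwartzMap ℝ ℝ, ∀ x, g x = f x

/-- The `L¹(ℝ)` norm `‖f‖₁ = ∫ |f(ξ)| dξ`. -/
def L1norm (f : ℝ → ℂ) : ℝ := ∫ ξ : ℝ, ‖f ξ‖

/-- The modified Bessel function of the second kind,
`K_ν(t) = ∫₀^∞ exp(−t·cosh(s))·cosh(νs) ds`. -/
def besselK (ν t : ℝ) : ℝ :=
  ∫ s in Set.Ioi (0 : ℝ), Real.exp (-t * Real.cosh s) * Real.cosh (ν * s)

/-- Kummer's confluent hypergeometric function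
`M(a,b,z) = Σ_{n=0}^∞ ((a)_n/(b)_n)·zⁿ/n!` with `(a)_n = Γ(a+n)/Γ(a)`. -/
def kummerM (a b z : ℝ) : ℝ :=
  ∑' n : ℕ, (Real.Gamma (a + n) / Real.Gamma a) / (Real.Gamma (b + n) / Real.Gamma b)
      * z ^ n / (Nat.factorial n : ℝ)

/-- The standing hypotheses on the bump function `b̂`: it is smooth, compactly supported,
equal to `1` on `[−λ, λ]`, takes values in `[0, 1]`, and is supported inside
`(−√2·λ, √2·λ)`. -/
def BumpHyp (lam : ℝ) (b : ℝ → ℝ) : Prop :=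
  ContDiff ℝ (⊤ : ℕ∞) b ∧ HasCompactSupport b ∧
    (∀ ξ : ℝ, |ξ| ≤ lam → b ξ = 1) ∧ (∀ ξ : ℝ, 0 ≤ b ξ ∧ b ξ ≤ 1) ∧
    tsupport b ⊆ Set.Ioo (-(Real.sqrt 2 * lam)) (Real.sqrt 2 * lam)



lemma FT_eq_fourier (f : ℝ → ℝ) (ξ : ℝ) :
    FT f ξ = FourierTransform.fourier (fun x => (f x : ℂ)) (ξ / (2 * Real.pi)) := by
  rw [Real.fourier_real_eq_integral_exp_smul, FT]
  congr 1
  ext x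
  rw [smul_eq_mul]
  congr 2
  have : (Real.pi : ℂ) ≠ 0 := by exact_mod_cast Real.pi_ne_zero
  push_cast
  field_simp

lemma FT_neg (f : ℝ → ℝ) (ξ : ℝ) : FT f (-ξ) = (starRingEnd ℂ) (FT f ξ) := by
  rw [FT, FT, ← integral_conj]
  congr 1
  ext x
  simp [← Complex.exp_conj]

lemma continuous_FT {f : ℝ → ℝ} (hf : Integrable f) : Continuous (FT f) := by
  have h : FT f = fun ξ => FourierTransform.fourier (fun x => (f x : ℂ)) (ξ / (2 * Real.pi)) :=
    funext (FT_eq_fourier f)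
  rw [h]
  exact (VectorFourier.fourierIntegral_continuous Real.continuous_fourierChar (by fun_prop)
    hf.ofReal).comp (by fun_prop : Continuous fun ξ : ℝ => ξ / (2 * Real.pi))

/-- Fourier inversion in the normalization of `FT`. -/
lemma inversion_FT {f : ℝ → ℝ} (hf : Integrable f) (hfc : Continuous f)
    (hFT : Integrable (FT f)) (x : ℝ) :
    ((1 / (2 * Real.pi) : ℝ) : ℂ) * ∫ ξ : ℝ, Complex.exp (Complex.I * x * ξ) * FT f ξ = f x := by
  have hpi : (0 : ℝ) < 2 * Real.pi := by positivity
  set g : ℝ → ℂ := fun x => (f x : ℂ) with hg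
  have hgF : Integrable (FourierTransform.fourier g) := by
    have := hFT.comp_mul_left' hpi.ne'
    refine this.congr (Eventually.of_forall fun η => ?_)
    simp only [FT_eq_fourier]
    rw [mul_div_cancel_left₀ _ hpi.ne']
  have hinv := congrFun (Continuous.fourierInv_fourier_eq (f := g)
    (Complex.continuous_ofReal.comp hfc) hf.ofReal hgF) x
  rw [Real.fourierInv_eq'] at hinv
  have hsub := Measure.integral_comp_div
    (fun η : ℝ => Complex.exp (((2 * Real.pi * inner ℝ η x : ℝ) : ℂ) * Complex.I) •
      FourierTransform.fourier g η) (2 * Real.pi)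
  rw [hinv] at hsub
  have hpic : (Real.pi : ℂ) ≠ 0 := by exact_mod_cast Real.pi_ne_zero
  have heq : ∀ ξ : ℝ, Complex.exp (Complex.I * x * ξ) * FT f ξ =
      Complex.exp (((2 * Real.pi * inner ℝ (ξ / (2 * Real.pi)) x : ℝ) : ℂ) * Complex.I) •
      FourierTransform.fourier g (ξ / (2 * Real.pi)) := by
    intro ξ
    rw [FT_eq_fourier, smul_eq_mul]
    congr 2
    have hin : inner ℝ (ξ / (2 * Real.pi)) x = ξ / (2 * Real.pi) * x := by simp [mul_comm]
    rw [hin]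
    push_cast
    field_simp
  simp_rw [heq]
  rw [hsub, abs_of_pos hpi, Complex.real_smul]
  simp only [hg]
  push_cast
  field_simp

lemma hasDerivAt_integral_exp_mul {h : ℝ → ℂ} (hh : Integrable h)
    (hh' : Integrable fun ξ : ℝ => (ξ : ℂ) * h ξ) (x : ℝ) :
    HasDerivAt (fun x : ℝ => ∫ ξ : ℝ, Complex.exp (Complex.I * x * ξ) * h ξ)
      (∫ ξ : ℝ, Complex.exp (Complex.I * x * ξ) * (Complex.I * (ξ * h ξ))) x := by
  have hc : ∀ x : ℝ, Continuous fun ξ : ℝ => Complex.exp (Complex.I * x * ξ) := by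
    intro x; fun_prop
  have hnorm : ∀ x ξ : ℝ, ‖Complex.exp (Complex.I * x * ξ)‖ = 1 := by
    intro x ξ
    rw [mul_assoc, mul_comm, ← Complex.ofReal_mul]
    exact Complex.norm_exp_ofReal_mul_I _
  refine (hasDerivAt_integral_of_dominated_loc_of_deriv_le (s := Set.univ)
    (F := fun (x : ℝ) (ξ : ℝ) => Complex.exp (Complex.I * x * ξ) * h ξ)
    (F' := fun (x : ℝ) (ξ : ℝ) => Complex.exp (Complex.I * x * ξ) * (Complex.I * (ξ * h ξ)))
    (bound := fun ξ : ℝ => ‖(ξ : ℂ) * h ξ‖) univ_mem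
    (Eventually.of_forall fun y => (hc y).aestronglyMeasurable.mul hh.1) ?_
    ((hc x).aestronglyMeasurable.mul (hh'.1.const_mul _)) ?_ hh'.norm ?_).2
  · exact hh.bdd_mul (c := 1) (hc x).aestronglyMeasurable
      (Eventually.of_forall fun ξ => (hnorm x ξ).le)
  · refine Eventually.of_forall fun ξ y _ => ?_
    rw [norm_mul, hnorm, norm_mul, Complex.norm_I, one_mul, one_mul]
  · refine Eventually.of_forall fun ξ y _ => ?_
    have h1 : HasDerivAt (fun y : ℝ => Complex.I * y * ξ) (Complex.I * ξ) y := by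
      simpa using ((Complex.ofRealCLM.hasDerivAt (x := y)).const_mul Complex.I).mul_const (ξ : ℂ)
    convert! h1.cexp.mul_const (h ξ) using 1
    ring

/-- For band-limited `σ`, the function `T[σ]` is real valued and solves
`T[σ]'' + 4λ² T[σ] = σ`. -/
lemma exists_OpT_solution {lam : ℝ} (hlam : 0 < lam) {σ : ℝ → ℝ} (hσ : Integrable σ)
    (hσc : Continuous σ) (hsupp : ∀ ξ : ℝ, |ξ| > Real.sqrt 2 * lam → FT σ ξ = 0) :
    ∃ d d₁ d₂ : ℝ → ℝ, (∀ x, OpT lam σ x = d x) ∧ (∀ x, HasDerivAt d (d₁ x) x) ∧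
      (∀ x, HasDerivAt d₁ (d₂ x) x) ∧ ∀ x, d₂ x + 4 * lam ^ 2 * d x = σ x := by
  have hFTc := continuous_FT hσ
  have hcpt : HasCompactSupport (FT σ) := by
    refine HasCompactSupport.intro (K := Set.Icc (-(Real.sqrt 2 * lam)) (Real.sqrt 2 * lam))
      isCompact_Icc fun ξ hξ => hsupp ξ ?_
    by_contra! h
    exact hξ (abs_le.1 h)
  have hden : ∀ ξ : ℝ, |ξ| ≤ Real.sqrt 2 * lam → 2 * lam ^ 2 ≤ 4 * lam ^ 2 - ξ ^ 2 := by
    intro ξ hξ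
    have h1 := pow_le_pow_left₀ (abs_nonneg ξ) hξ 2
    rw [sq_abs, mul_pow, Real.sq_sqrt (by norm_num)] at h1
    linarith
  set h : ℝ → ℂ := fun ξ => FT σ ξ / ((4 * lam ^ 2 - ξ ^ 2 : ℝ) : ℂ) with hh
  have hhmeas : AEStronglyMeasurable h := by
    have : Measurable h := hFTc.measurable.div (by fun_prop)
    exact this.aestronglyMeasurable
  have hhle : ∀ ξ, ‖h ξ‖ ≤ (2 * lam ^ 2)⁻¹ * ‖FT σ ξ‖ := by
    intro ξ
    by_cases hξ : |ξ| ≤ Real.sqrt 2 * lam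
    · have h1 := hden ξ hξ
      have h0 : 0 < 2 * lam ^ 2 := by positivity
      simp only [hh]
      rw [norm_div, Complex.norm_real, Real.norm_eq_abs, abs_of_pos (h0.trans_le h1),
        div_eq_mul_inv, mul_comm]
      gcongr
    · simp [hh, hsupp ξ (not_le.1 hξ)]
  have hint : ∀ n : ℕ, Integrable fun ξ : ℝ => (ξ : ℂ) ^ n * h ξ := by
    intro n
    have h1 : Integrable fun ξ : ℝ => (ξ : ℂ) ^ n * FT σ ξ := by
      apply Continuous.integrable_of_hasCompactSupport
      · fun_prop
      · exact hcpt.mul_left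
    refine (h1.norm.const_mul (2 * lam ^ 2)⁻¹).mono'
      ((by fun_prop : Continuous fun ξ : ℝ => (ξ : ℂ) ^ n).aestronglyMeasurable.mul hhmeas) ?_
    refine Eventually.of_forall fun ξ => ?_
    rw [norm_mul, norm_mul]
    have := mul_le_mul_of_nonneg_left (hhle ξ) (norm_nonneg ((ξ : ℂ) ^ n))
    linarith
  have hi0 : Integrable h := by simpa using hint 0
  have hi1 : Integrable fun ξ : ℝ => (ξ : ℂ) * h ξ := by simpa using hint 1
  have hi2 : Integrable fun ξ : ℝ => (ξ : ℂ) * (Complex.I * (ξ * h ξ)) := by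
    refine ((hint 2).const_mul Complex.I).congr (Eventually.of_forall fun ξ => ?_)
    simp only; ring
  set c : ℂ := ((1 / (2 * Real.pi) : ℝ) : ℂ) with hc
  have hOp : ∀ x, OpT lam σ x = c * ∫ ξ : ℝ, Complex.exp (Complex.I * x * ξ) * h ξ := by
    intro x
    simp only [OpT, hh, mul_div_assoc, hc]
  have hreal : ∀ x, (starRingEnd ℂ) (OpT lam σ x) = OpT lam σ x := by
    intro x
    rw [hOp, map_mul, hc, Complex.conj_ofReal, ← integral_conj]
    congr 1
    rw [← integral_neg_eq_self]
    congr 1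
    ext ξ
    simp [hh, ← Complex.exp_conj, FT_neg, map_ofNat]
  set D₁ : ℝ → ℂ := fun x => c * ∫ ξ : ℝ, Complex.exp (Complex.I * x * ξ) *
    (Complex.I * (ξ * h ξ)) with hD₁
  set D₂ : ℝ → ℂ := fun x => c * ∫ ξ : ℝ, Complex.exp (Complex.I * x * ξ) *
    (Complex.I * (ξ * (Complex.I * (ξ * h ξ)))) with hD₂
  have hd1 : ∀ x, HasDerivAt (OpT lam σ) (D₁ x) x := by
    intro x
    rw [funext hOp]
    exact (hasDerivAt_integral_exp_mul hi0 hi1 x).const_mul c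
  have hd2 : ∀ x, HasDerivAt D₁ (D₂ x) x := by
    intro x
    exact (hasDerivAt_integral_exp_mul (hi1.const_mul Complex.I) hi2 x).const_mul c
  refine ⟨fun x => (OpT lam σ x).re, fun x => (D₁ x).re, fun x => (D₂ x).re,
    fun x => (Complex.conj_eq_iff_re.1 (hreal x)).symm,
    fun x => Complex.reCLM.hasFDerivAt.comp_hasDerivAt x (hd1 x),
    fun x => Complex.reCLM.hasFDerivAt.comp_hasDerivAt x (hd2 x), fun x => ?_⟩
  have hexp : ∀ {k : ℝ → ℂ}, Integrable k →
      Integrable fun ξ : ℝ => Complex.exp (Complex.I * x * ξ) * k ξ := by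
    intro k hk
    refine hk.bdd_mul (c := 1)
      (by fun_prop : Continuous fun ξ : ℝ => Complex.exp (Complex.I * x * ξ)).aestronglyMeasurable
      (Eventually.of_forall fun ξ => le_of_eq ?_)
    rw [mul_assoc, mul_comm, ← Complex.ofReal_mul]
    exact Complex.norm_exp_ofReal_mul_I _
  have hsum : D₂ x + ((4 * lam ^ 2 : ℝ) : ℂ) * OpT lam σ x = σ x := by
    rw [← inversion_FT hσ hσc (hFTc.integrable_of_hasCompactSupport hcpt) x, hOp, hD₂,
      mul_left_comm, ← mul_add, ← integral_const_mul, ← integral_add (hexp (hi2.const_mul _))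
      ((hexp hi0).const_mul _)]
    congr 2
    ext ξ
    have hkey : ((4 * lam ^ 2 - ξ ^ 2 : ℝ) : ℂ) * h ξ = FT σ ξ := by
      by_cases hξ : |ξ| ≤ Real.sqrt 2 * lam
      · have h1 := hden ξ hξ
        have h0 : 0 < 2 * lam ^ 2 := by positivity
        exact mul_div_cancel₀ _ (by exact_mod_cast (h0.trans_le h1).ne')
      · simp [hh, hsupp ξ (not_le.1 hξ)]
    rw [← hkey]
    push_cast
    linear_combination (Complex.exp (Complex.I * x * ξ) * ξ ^ 2 * h ξ) * Complex.I_sq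
  have := congrArg Complex.re hsum
  rwa [Complex.add_re, Complex.re_ofReal_mul (4 * lam ^ 2), Complex.ofReal_re] at this

lemma abs_re_OpT_le {lam Γ μ : ℝ} (hΓ : 0 < Γ) (hμ : 0 < μ) (hlam : lam > 2 * max (1 / μ) Γ)
    {σ : ℝ → ℝ} (hsupp : ∀ ξ : ℝ, |ξ| > Real.sqrt 2 * lam → FT σ ξ = 0)
    (hbd : ∀ ξ : ℝ, |ξ| ≤ Real.sqrt 2 * lam →
      ‖FT σ ξ‖ ≤ (1 + 2 * Γ / lam) * Γ * Real.exp (-μ * |ξ|)) (x : ℝ) :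
    |(OpT lam σ x).re| ≤ 1 := by
  have hl1 : 2 / μ < lam := by
    have := le_max_left (1 / μ) Γ
    rw [div_eq_mul_one_div]; linarith
  have hl2 : 2 * Γ < lam := by have := le_max_right (1 / μ) Γ; linarith
  have hl0 : 0 < lam := by linarith
  have hI : ∫ ξ : ℝ, Real.exp (-μ * |ξ|) = 2 / μ := by
    rw [integral_comp_abs (f := fun ξ => Real.exp (-μ * ξ)), integral_exp_mul_Ioi (by linarith)]
    simp
    field_simp
  have hint : Integrable fun ξ : ℝ => Real.exp (-μ * |ξ|) :=
    Integrable.of_integral_ne_zero (by rw [hI]; positivity)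
  refine (Complex.abs_re_le_norm _).trans ?_
  rw [OpT, norm_mul, Complex.norm_real, Real.norm_eq_abs, abs_of_pos (by positivity)]
  have hle : ‖∫ ξ : ℝ, Complex.exp (Complex.I * (x:ℂ) * (ξ:ℂ)) * FT σ ξ /
      (((4 * lam ^ 2 - ξ ^ 2 : ℝ)) : ℂ)‖ ≤ ∫ ξ : ℝ, Γ / lam ^ 2 * Real.exp (-μ * |ξ|) := by
    refine norm_integral_le_of_norm_le (hint.const_mul _) (Eventually.of_forall fun ξ => ?_)
    by_cases hξ : |ξ| ≤ Real.sqrt 2 * lam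
    · have h1 := pow_le_pow_left₀ (abs_nonneg ξ) hξ 2
      rw [sq_abs, mul_pow, Real.sq_sqrt (by norm_num)] at h1
      have h0 : 0 < 2 * lam ^ 2 := by positivity
      have h2 : 2 * lam ^ 2 ≤ 4 * lam ^ 2 - ξ ^ 2 := by linarith
      have h3 : ‖Complex.exp (Complex.I * x * ξ)‖ = 1 := by
        rw [mul_assoc, mul_comm, ← Complex.ofReal_mul]
        exact Complex.norm_exp_ofReal_mul_I _
      have h4 : 2 * Γ / lam ≤ 1 := by rw [div_le_one hl0]; exact hl2.le
      rw [norm_div, norm_mul, h3, one_mul, Complex.norm_real, Real.norm_eq_abs,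
        abs_of_pos (h0.trans_le h2)]
      calc ‖FT σ ξ‖ / (4 * lam ^ 2 - ξ ^ 2)
          ≤ (1 + 2 * Γ / lam) * Γ * Real.exp (-μ * |ξ|) / (2 * lam ^ 2) := by
            gcongr
            exact hbd ξ hξ
        _ ≤ (1 + 1) * Γ * Real.exp (-μ * |ξ|) / (2 * lam ^ 2) := by gcongr
        _ = _ := by ring
    · simp only [hsupp ξ (not_le.1 hξ), mul_zero, zero_div, norm_zero]
      positivity
  rw [integral_const_mul, hI] at hle
  have h5 : 2 ≤ lam * μ := ((div_lt_iff₀ hμ).1 hl1).le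
  have h6 : Γ / lam ^ 2 * (2 / μ) ≤ 1 := by
    rw [div_mul_div_comm, div_le_one (by positivity)]
    nlinarith
  have h7 : 1 / (2 * Real.pi) ≤ 1 := by
    rw [div_le_one (by positivity)]
    linarith [Real.pi_gt_three]
  exact mul_le_one₀ h7 (norm_nonneg _) (hle.trans h6)

/-- The system `y' = z`, `z' = -Q y` has a solution on `[A, B]` with prescribed initial values. -/
lemma exists_second_order_solution {Q : ℝ → ℝ} (hQ : Continuous Q) {A B : ℝ} (hAB : A < B)
    (y₀ y₁ : ℝ) :
    ∃ y z : ℝ → ℝ, y A = y₀ ∧ z A = y₁ ∧ ContinuousOn y (Set.Icc A B) ∧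
      ContinuousOn z (Set.Icc A B) ∧
      ∀ t ∈ Set.Ioo A B, HasDerivAt y (z t) t ∧ HasDerivAt z (-Q t * y t) t := by
  obtain ⟨M, hM⟩ := isCompact_Icc.exists_bound_of_continuousOn (hQ.continuousOn (s := Set.Icc A B))
  have hM0 : 0 ≤ M := (norm_nonneg _).trans (hM A ⟨le_rfl, hAB.le⟩)
  set K : ℝ := M + 1
  have hK : 0 ≤ K := by positivity
  set R : ℝ := ‖(y₀, y₁)‖ * Real.exp (K * (B - A))
  have hR : 0 ≤ R := by positivity
  set clip : ℝ → ℝ := fun x => max (-R) (min R x) with hclip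
  have clip_id : ∀ x, |x| ≤ R → clip x = x := by
    intro x hx
    simp [hclip, (abs_le.1 hx).1, (abs_le.1 hx).2]
  have clip_le : ∀ x, |clip x| ≤ R := by
    intro x
    simp [hclip, abs_le, hR]
  have clip_le' : ∀ x, |clip x| ≤ |x| := by
    intro x
    simp only [hclip]
    rcases abs_cases x with h | h <;> rw [abs_le] <;> constructor <;>
      simp only [le_max_iff, le_min_iff, max_le_iff, min_le_iff] <;> grind
  have clip_lip : ∀ x y, |clip x - clip y| ≤ |x - y| := by
    intro x y
    exact (abs_max_sub_max_le_max _ _ _ _).trans (by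
      simpa using (abs_min_sub_min_le_max R x R y))
  set f : ℝ → ℝ × ℝ → ℝ × ℝ := fun t x => (clip x.2, -Q t * clip x.1) with hf
  have hpl : IsPicardLindelof f (tmin := A) (tmax := B) ⟨A, le_rfl, hAB.le⟩ (y₀, y₁)
      (Real.toNNReal (K * R * (B - A))) 0 (Real.toNNReal (K * R)) (Real.toNNReal K) := by
    refine ⟨fun t ht => LipschitzOnWith.of_dist_le_mul fun x _ y _ => ?_, fun x _ => ?_,
      fun t ht x _ => ?_, ?_⟩
    · rw [Real.coe_toNNReal _ hK, Prod.dist_eq, Prod.dist_eq]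
      simp only [hf, Real.dist_eq]
      have hq := hM t ht
      rw [Real.norm_eq_abs] at hq
      have h1 := clip_lip x.1 y.1
      have h2 := clip_lip x.2 y.2
      have h3 := le_max_left |x.1 - y.1| |x.2 - y.2|
      have h4 := le_max_right |x.1 - y.1| |x.2 - y.2|
      have h5 := abs_nonneg (x.1 - y.1)
      refine max_le ?_ ?_
      · simp only [K]; nlinarith
      · rw [← mul_sub, abs_mul, abs_neg]
        calc |Q t| * |clip x.1 - clip y.1| ≤ M * max |x.1 - y.1| |x.2 - y.2| := by
              gcongr; exact h1.trans h3
          _ ≤ _ := by simp only [K]; nlinarith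
    · simp only [hf]; fun_prop
    · rw [Real.coe_toNNReal _ (by positivity), Prod.norm_def]
      simp only [hf, Real.norm_eq_abs]
      have hq := hM t ht
      rw [Real.norm_eq_abs] at hq
      refine max_le ?_ ?_
      · have := clip_le x.2
        simp only [K]; nlinarith
      · rw [abs_mul, abs_neg]
        have := clip_le x.1
        calc |Q t| * |clip x.1| ≤ M * R := by gcongr
          _ ≤ _ := by simp only [K]; nlinarith
    · have : 0 ≤ B - A := by linarith
      rw [Real.coe_toNNReal _ (by positivity), Real.coe_toNNReal _ (by positivity)]
      simp [hAB.le]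
  obtain ⟨x, hx0, hx⟩ := hpl.exists_eq_forall_mem_Icc_hasDerivWithinAt₀
  have hcont : ContinuousOn x (Set.Icc A B) := fun t ht => (hx t ht).continuousWithinAt
  have hbound : ∀ t ∈ Set.Icc A B, ‖x t‖ ≤ R := by
    intro t ht
    have := norm_le_gronwallBound_of_norm_deriv_right_le (f' := fun t => f t (x t)) (K := K)
      (ε := 0) hcont
      (fun t ht => ((hx t ⟨ht.1, ht.2.le⟩).mono_of_mem_nhdsWithin
        (Icc_mem_nhdsGE_of_mem ht))) (le_of_eq (congrArg norm hx0)) (fun t ht => ?_) t ht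
    · rw [gronwallBound_ε0] at this
      refine this.trans ?_
      simp only [R]
      have h2 := ht.2
      gcongr
    · have hq := hM t ⟨ht.1, ht.2.le⟩
      rw [Real.norm_eq_abs] at hq
      simp only [hf, Prod.norm_def, Real.norm_eq_abs, add_zero]
      have h1 := clip_le' (x t).1
      have h2 := clip_le' (x t).2
      have h3 := le_max_left |(x t).1| |(x t).2|
      have h4 := le_max_right |(x t).1| |(x t).2|
      have h5 := abs_nonneg (x t).1
      refine max_le ?_ ?_
      · simp only [K]; nlinarith
      · rw [abs_mul, abs_neg]
        calc |Q t| * |clip (x t).1| ≤ M * max |(x t).1| |(x t).2| := by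
              gcongr; exact h1.trans h3
          _ ≤ _ := by simp only [K]; nlinarith
  refine ⟨fun t => (x t).1, fun t => (x t).2, congrArg Prod.fst hx0, congrArg Prod.snd hx0,
    hcont.fst, hcont.snd, fun t ht => ?_⟩
  have htI := Set.Ioo_subset_Icc_self ht
  have hd := (hx t htI).hasDerivAt (Icc_mem_nhds ht.1 ht.2)
  have hb := hbound t htI
  rw [Prod.norm_def, Real.norm_eq_abs, Real.norm_eq_abs] at hb
  have e1 := clip_id _ ((le_max_left _ _).trans hb)
  have e2 := clip_id _ ((le_max_right _ _).trans hb)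
  simp only [hf, e1, e2] at hd
  exact ⟨(ContinuousLinearMap.fst ℝ ℝ ℝ).hasFDerivAt.comp_hasDerivAt t hd,
    (ContinuousLinearMap.snd ℝ ℝ ℝ).hasFDerivAt.comp_hasDerivAt t hd⟩

/-- Energy estimate for `w'' + k² q w = f` with vanishing initial data. -/
lemma energy_estimate {A B k K F : ℝ} {q q' w z f : ℝ → ℝ} (hAB : A < B) (hK : 0 ≤ K)
    (hqpos : ∀ t, 0 < q t) (hq : ∀ t, HasDerivAt q (q' t) t)
    (hqK : ∀ t ∈ Set.Icc A B, q' t ≤ K * q t)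
    (hw : ContinuousOn w (Set.Icc A B)) (hz : ContinuousOn z (Set.Icc A B))
    (hw' : ∀ t ∈ Set.Ioo A B, HasDerivAt w (z t) t)
    (hz' : ∀ t ∈ Set.Ioo A B, HasDerivAt z (-(k ^ 2 * q t) * w t + f t) t)
    (hf : ∀ t ∈ Set.Icc A B, |f t| ≤ F) (hwA : w A = 0) (hzA : z A = 0) :
    ∀ t ∈ Set.Icc A B,
      k ^ 2 * q t * w t ^ 2 ≤ F ^ 2 * ((B - A) * Real.exp ((K + 1) * (B - A))) := by
  have hqc : Continuous q := continuous_iff_continuousAt.2 fun t => (hq t).continuousAt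
  set E : ℝ → ℝ := fun t => z t ^ 2 + k ^ 2 * q t * w t ^ 2 with hE
  set G : ℝ → ℝ := fun t => E t * Real.exp (-((K + 1) * (t - A))) - F ^ 2 * (t - A) with hG
  have hEd : ∀ t ∈ Set.Ioo A B, HasDerivAt E (2 * z t * f t + k ^ 2 * q' t * w t ^ 2) t := by
    intro t ht
    convert! ((hz' t ht).pow 2).add ((((hq t).const_mul (k ^ 2))).mul ((hw' t ht).pow 2)) using 1
    simp; ring
  have hGd : ∀ t ∈ Set.Ioo A B, HasDerivAt G
      ((2 * z t * f t + k ^ 2 * q' t * w t ^ 2) * Real.exp (-((K + 1) * (t - A))) +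
        E t * (Real.exp (-((K + 1) * (t - A))) * -(K + 1)) - F ^ 2) t := by
    intro t ht
    have h1 : HasDerivAt (fun t => -((K + 1) * (t - A))) (-(K + 1)) t := by
      convert! (((hasDerivAt_id t).sub_const A).const_mul (K + 1)).neg using 1
      simp
    have h2 : HasDerivAt (fun t => F ^ 2 * (t - A)) (F ^ 2) t := by
      simpa using (((hasDerivAt_id t).sub_const A).const_mul (F ^ 2))
    exact ((hEd t ht).mul h1.exp).sub h2
  have hanti : AntitoneOn G (Set.Icc A B) := by
    apply antitoneOn_of_deriv_nonpos (convex_Icc A B)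
    · simp only [hG, hE]; fun_prop
    · rw [interior_Icc]
      exact fun t ht => (hGd t ht).differentiableAt.differentiableWithinAt
    · rw [interior_Icc]
      intro t ht
      rw [(hGd t ht).deriv]
      have htI := Set.Ioo_subset_Icc_self ht
      set e := Real.exp (-((K + 1) * (t - A)))
      have he0 : 0 < e := Real.exp_pos _
      have he1 : e ≤ 1 := Real.exp_le_one_iff.2 (by nlinarith [ht.1])
      have hf2 : f t ^ 2 ≤ F ^ 2 := sq_le_sq' (abs_le.1 (hf t htI)).1 (abs_le.1 (hf t htI)).2
      have h3 : k ^ 2 * q' t * w t ^ 2 ≤ K * (k ^ 2 * q t * w t ^ 2) := by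
        have := mul_le_mul_of_nonneg_left (hqK t htI) (mul_nonneg (sq_nonneg k) (sq_nonneg (w t)))
        nlinarith
      have h4 : 0 ≤ k ^ 2 * q t * w t ^ 2 := by have := hqpos t; positivity
      have h5 : 2 * z t * f t ≤ z t ^ 2 + F ^ 2 := by nlinarith [sq_nonneg (z t - f t)]
      have h6 : 2 * z t * f t + k ^ 2 * q' t * w t ^ 2 - (K + 1) * E t ≤ F ^ 2 := by
        simp only [hE]; nlinarith [mul_nonneg hK (sq_nonneg (z t))]
      nlinarith [mul_le_mul_of_nonneg_right h6 he0.le,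
        mul_le_mul_of_nonneg_left he1 (sq_nonneg F)]
  intro t ht
  have h := hanti ⟨le_rfl, hAB.le⟩ ht ht.1
  have hGA : G A = 0 := by simp [hG, hE, hwA, hzA]
  rw [hGA] at h
  simp only [hG] at h
  have h1 : E t * Real.exp (-((K + 1) * (t - A))) ≤ F ^ 2 * (B - A) := by
    nlinarith [ht.2, sq_nonneg F]
  have h2 : E t ≤ F ^ 2 * (B - A) * Real.exp ((K + 1) * (t - A)) := by
    rw [Real.exp_neg, ← div_eq_mul_inv, div_le_iff₀ (Real.exp_pos _)] at h1
    exact h1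
  have h3 : Real.exp ((K + 1) * (t - A)) ≤ Real.exp ((K + 1) * (B - A)) := by
    have := ht.2
    gcongr
  have h4 : 0 ≤ F ^ 2 * (B - A) := mul_nonneg (sq_nonneg F) (by linarith)
  calc k ^ 2 * q t * w t ^ 2 ≤ E t := by simp only [hE]; nlinarith [sq_nonneg (z t)]
    _ ≤ F ^ 2 * (B - A) * Real.exp ((K + 1) * (B - A)) := h2.trans (by gcongr)
    _ = _ := by ring

lemma exists_nearby_solution {A B k K F : ℝ} {q q' u u₁ f : ℝ → ℝ} (hAB : A < B) (hK : 0 ≤ K)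
    (hqpos : ∀ t, 0 < q t) (hq : ∀ t, HasDerivAt q (q' t) t)
    (hqK : ∀ t ∈ Set.Icc A B, q' t ≤ K * q t)
    (hu : ∀ t, HasDerivAt u (u₁ t) t)
    (hu₁ : ∀ t, HasDerivAt u₁ (-(k ^ 2 * q t) * u t + f t) t)
    (hf : ∀ t ∈ Set.Icc A B, |f t| ≤ F) :
    ∃ y z : ℝ → ℝ, y A = u A ∧ z A = u₁ A ∧ ContinuousOn y (Set.Icc A B) ∧
      ContinuousOn z (Set.Icc A B) ∧
      (∀ t ∈ Set.Ioo A B, HasDerivAt y (z t) t ∧ HasDerivAt z (-(k ^ 2 * q t) * y t) t) ∧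
      ∀ t ∈ Set.Icc A B,
        k ^ 2 * q t * (u t - y t) ^ 2 ≤ F ^ 2 * ((B - A) * Real.exp ((K + 1) * (B - A))) := by
  have hqc : Continuous q := continuous_iff_continuousAt.2 fun t => (hq t).continuousAt
  obtain ⟨y, z, hyA, hzA, hy, hz, hyz⟩ := exists_second_order_solution
    (Q := fun t => k ^ 2 * q t) (by fun_prop) hAB (u A) (u₁ A)
  refine ⟨y, z, hyA, hzA, hy, hz, hyz, ?_⟩
  have huc : Continuous u := continuous_iff_continuousAt.2 fun t => (hu t).continuousAt
  have hu₁c : Continuous u₁ := continuous_iff_continuousAt.2 fun t => (hu₁ t).continuousAt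
  refine energy_estimate (w := fun t => u t - y t) (z := fun t => u₁ t - z t) (f := f) hAB hK hqpos
    hq hqK (huc.continuousOn.sub hy) (hu₁c.continuousOn.sub hz)
    (fun t ht => (hu t).sub (hyz t ht).1) (fun t ht => ?_) hf (by simp [hyA]) (by simp [hzA])
  convert! (hu₁ t).sub (hyz t ht).2 using 1
  ring

lemma solution_regularity {A B a b : ℝ} (hAa : A < a) (hbB : b < B) {Q y z : ℝ → ℝ}
    (hQ : Continuous Q)
    (h : ∀ t ∈ Set.Ioo A B, HasDerivAt y (z t) t ∧ HasDerivAt z (-Q t * y t) t) :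
    ContDiffOn ℝ 2 y (Set.Icc a b) ∧ ∀ t ∈ Set.Icc a b, deriv (deriv y) t + Q t * y t = 0 := by
  have hsub : Set.Icc a b ⊆ Set.Ioo A B := fun t ht => ⟨hAa.trans_le ht.1, ht.2.trans_lt hbB⟩
  have hy : ∀ t ∈ Set.Ioo A B, deriv y t = z t := fun t ht => (h t ht).1.deriv
  have hz : ∀ t ∈ Set.Ioo A B, deriv z t = -Q t * y t := fun t ht => (h t ht).2.deriv
  have hyd : DifferentiableOn ℝ y (Set.Ioo A B) := fun t ht =>
    (h t ht).1.differentiableAt.differentiableWithinAt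
  have hzd : DifferentiableOn ℝ z (Set.Ioo A B) := fun t ht =>
    (h t ht).2.differentiableAt.differentiableWithinAt
  constructor
  · refine ContDiffOn.mono ?_ hsub
    have hz1 : ContDiffOn ℝ 1 z (Set.Ioo A B) := by
      rw [show (1 : WithTop ℕ∞) = 0 + 1 by rfl, contDiffOn_succ_iff_deriv_of_isOpen isOpen_Ioo]
      refine ⟨hzd, by simp, contDiffOn_zero.2 ?_⟩
      exact (hQ.neg.continuousOn.mul hyd.continuousOn).congr hz
    rw [show (2 : WithTop ℕ∞) = 1 + 1 by rfl, contDiffOn_succ_iff_deriv_of_isOpen isOpen_Ioo]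
    exact ⟨hyd, by simp, hz1.congr hy⟩
  · intro t ht
    have hev : deriv y =ᶠ[nhds t] z :=
      (isOpen_Ioo.eventually_mem (hsub ht)).mono fun s hs => hy s hs
    rw [hev.deriv_eq, hz t (hsub ht)]
    ring

lemma solutions_linearIndependent {A B a b : ℝ} (hAa : A < a) (hab : a < b) (hbB : b < B)
    {Q y z y' z' : ℝ → ℝ}
    (hy : ContinuousOn y (Set.Icc A B)) (hz : ContinuousOn z (Set.Icc A B))
    (hy' : ContinuousOn y' (Set.Icc A B)) (hz' : ContinuousOn z' (Set.Icc A B))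
    (h : ∀ t ∈ Set.Ioo A B, HasDerivAt y (z t) t ∧ HasDerivAt z (-Q t * y t) t)
    (h' : ∀ t ∈ Set.Ioo A B, HasDerivAt y' (z' t) t ∧ HasDerivAt z' (-Q t * y' t) t)
    (hW : y A * z' A - y' A * z A ≠ 0) (c d : ℝ)
    (hcd : ∀ t ∈ Set.Icc a b, c * y t + d * y' t = 0) : c = 0 ∧ d = 0 := by
  obtain ⟨t, hta, htb⟩ := exists_between hab
  have htA : A < t := hAa.trans hta
  have htB : t < B := htb.trans hbB
  have hsub : Set.Icc A t ⊆ Set.Icc A B := Set.Icc_subset_Icc_right htB.le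
  obtain ⟨e, he, hWe⟩ := exists_hasDerivAt_eq_slope (fun s => y s * z' s - y' s * z s)
    (fun _ => 0) htA
    (((hy.mul hz').sub (hy'.mul hz)).mono hsub) (fun s hs => by
      have hs' : s ∈ Set.Ioo A B := ⟨hs.1, hs.2.trans htB⟩
      convert! ((h s hs').1.mul (h' s hs').2).sub ((h' s hs').1.mul (h s hs').2) using 1
      ring)
  have hWt : y t * z' t - y' t * z t ≠ 0 := by
    rw [eq_div_iff (sub_ne_zero.2 htA.ne')] at hWe
    intro h0
    apply hW
    linarith
  have htm : t ∈ Set.Ioo A B := ⟨htA, htB⟩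
  have h0 := hcd t ⟨hta.le, htb.le⟩
  have h1 : c * z t + d * z' t = 0 := by
    have hd := ((h t htm).1.const_mul c).add ((h' t htm).1.const_mul d)
    refine hd.unique ((hasDerivAt_const t (0 : ℝ)).congr_of_eventuallyEq ?_)
    exact (isOpen_Ioo.eventually_mem (show t ∈ Set.Ioo a b from ⟨hta, htb⟩)).mono
      fun s hs => hcd s (Set.Ioo_subset_Icc_self hs)
  constructor
  · exact (mul_eq_zero.1 (by linear_combination z' t * h0 - y' t * h1 :
      c * (y t * z' t - y' t * z t) = 0)).resolve_right hWt
  · exact (mul_eq_zero.1 (by linear_combination y t * h1 - z t * h0 :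
      d * (y t * z' t - y' t * z t) = 0)).resolve_right hWt

lemma schwarzian_inverse {s s₁ s₂ X tX : ℝ → ℝ} (hs : ∀ t, 0 < s t)
    (hs₁ : ∀ t, HasDerivAt s (s₁ t) t) (hs₂ : ∀ t, HasDerivAt s₁ (s₂ t) t)
    (hX : ∀ t, HasDerivAt X (s t) t) (hl : Function.LeftInverse tX X)
    (hr : Function.RightInverse tX X) (t : ℝ) :
    schwarzian tX (X t) = -s₂ t / s t ^ 3 + 3 / 2 * s₁ t ^ 2 / s t ^ 4 := by
  have hmono : StrictMono X := strictMono_of_hasDerivAt_pos hX hs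
  have hcont : Continuous tX := by
    have : tX = (hmono.orderIsoOfSurjective X hr.surjective).symm := by
      ext x
      rw [← hr x, hl]
      exact (hmono.orderIsoOfSurjective_symm_apply_self X hr.surjective _).symm
    rw [this]
    exact OrderIso.continuous _
  have hd : ∀ x, HasDerivAt tX (s (tX x))⁻¹ x := fun x =>
    HasDerivAt.of_local_left_inverse hcont.continuousAt (hX _) (hs _).ne'
      (Eventually.of_forall hr)
  have hd1 : deriv tX = fun x => (s (tX x))⁻¹ := funext fun x => (hd x).deriv
  have hd2 : deriv (deriv tX) = fun x => -s₁ (tX x) / s (tX x) ^ 3 := by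
    rw [hd1]
    ext x
    have := hs (tX x)
    refine HasDerivAt.deriv ?_
    convert! ((hs₁ (tX x)).comp x (hd x)).inv this.ne' using 1
    simp only [Function.comp]
    field_simp
  have hd3 : deriv (deriv (deriv tX)) (X t) = -s₂ t / s t ^ 4 + 3 * s₁ t ^ 2 / s t ^ 5 := by
    rw [hd2]
    have h0 := hs (tX (X t))
    refine HasDerivAt.deriv ?_
    convert! (((hs₂ (tX (X t))).comp (X t) (hd (X t))).neg).div
      (((hs₁ (tX (X t))).comp (X t) (hd (X t))).pow 3) (pow_ne_zero 3 h0.ne') using 1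
    simp only [Function.comp, Pi.neg_apply, hl t, Pi.pow_apply]
    have := hs t
    field_simp
    ring
  rw [schwarzian, hd3, hd2, hd1]
  simp only [hl t]
  have := hs t
  field_simp
  ring

/-- If `α' = 1 / g²`, then `g cos α` and `g sin α` solve `u'' = (g''/g - 1/g⁴) u`. -/
lemma phase_hasDerivAt {g g₁ g₂ α : ℝ → ℝ} (hg : ∀ t, 0 < g t)
    (hg₁ : ∀ t, HasDerivAt g (g₁ t) t) (hg₂ : ∀ t, HasDerivAt g₁ (g₂ t) t)
    (hα : ∀ t, HasDerivAt α (1 / g t ^ 2) t) (t : ℝ) :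
    HasDerivAt (fun t => g t * Real.cos (α t))
        (g₁ t * Real.cos (α t) - Real.sin (α t) / g t) t ∧
      HasDerivAt (fun t => g₁ t * Real.cos (α t) - Real.sin (α t) / g t)
        ((g₂ t / g t - 1 / g t ^ 4) * (g t * Real.cos (α t))) t ∧
      HasDerivAt (fun t => g t * Real.sin (α t))
        (g₁ t * Real.sin (α t) + Real.cos (α t) / g t) t ∧
      HasDerivAt (fun t => g₁ t * Real.sin (α t) + Real.cos (α t) / g t)
        ((g₂ t / g t - 1 / g t ^ 4) * (g t * Real.sin (α t))) t := by
  have h0 := hg t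
  refine ⟨?_, ?_, ?_, ?_⟩
  · convert! (hg₁ t).mul (hα t).cos using 1
    field_simp
    ring
  · convert! ((hg₂ t).mul (hα t).cos).sub ((hα t).sin.div (hg₁ t) h0.ne') using 1
    field_simp
    ring
  · convert! (hg₁ t).mul (hα t).sin using 1
    field_simp
  · convert! ((hg₂ t).mul (hα t).sin).add ((hα t).cos.div (hg₁ t) h0.ne') using 1
    field_simp
    ring

/-- The amplitude `g = exp(-r/4)/√λ` with `r = 2 log s + d ∘ X` and `X' = s`. -/
lemma amplitude_hasDerivAt {lam : ℝ} (hlam : 0 < lam) {s s₁ s₂ d d₁ d₂ X : ℝ → ℝ}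
    (hs : ∀ t, 0 < s t) (hs₁ : ∀ t, HasDerivAt s (s₁ t) t) (hs₂ : ∀ t, HasDerivAt s₁ (s₂ t) t)
    (hd₁ : ∀ x, HasDerivAt d (d₁ x) x) (hd₂ : ∀ x, HasDerivAt d₁ (d₂ x) x)
    (hX : ∀ t, HasDerivAt X (s t) t) :
    let g : ℝ → ℝ := fun t => Real.exp (-(2 * Real.log (s t) + d (X t)) / 4) / Real.sqrt lam
    ∃ g₁ g₂ : ℝ → ℝ, (∀ t, HasDerivAt g (g₁ t) t) ∧ (∀ t, HasDerivAt g₁ (g₂ t) t) ∧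
      ∀ t, g₂ t / g t - 1 / g t ^ 4 = -(lam ^ 2 * s t ^ 2 + s t ^ 2 / 4 *
        (4 * lam ^ 2 * (Real.exp (d (X t)) - 1) + d₂ (X t) - d₁ (X t) ^ 2 / 4 -
          2 * (-s₂ t / s t ^ 3 + 3 / 2 * s₁ t ^ 2 / s t ^ 4))) := by
  intro g
  have hg0 : ∀ t, 0 < g t := fun t => by simp only [g]; positivity
  set r₁ : ℝ → ℝ := fun t => 2 * (s₁ t / s t) + d₁ (X t) * s t with hr₁
  set r₂ : ℝ → ℝ := fun t => 2 * ((s₂ t * s t - s₁ t * s₁ t) / s t ^ 2) +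
    (d₂ (X t) * s t * s t + d₁ (X t) * s₁ t) with hr₂
  have hr : ∀ t, HasDerivAt (fun t => 2 * Real.log (s t) + d (X t)) (r₁ t) t := fun t =>
    (((hs₁ t).log (hs t).ne').const_mul 2).add ((hd₁ (X t)).comp t (hX t))
  have hr' : ∀ t, HasDerivAt r₁ (r₂ t) t := fun t =>
    (((hs₂ t).div (hs₁ t) (hs t).ne').const_mul 2).add
      (((hd₂ (X t)).comp t (hX t)).mul (hs₁ t))
  have hg₁ : ∀ t, HasDerivAt g (-r₁ t / 4 * g t) t := by
    intro t
    convert! (((hr t).neg.div_const 4).exp).div_const (Real.sqrt lam) using 1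
    simp only [g, Pi.neg_apply]
    ring
  refine ⟨fun t => -r₁ t / 4 * g t, fun t => (r₁ t ^ 2 / 16 - r₂ t / 4) * g t, hg₁, fun t => ?_,
    fun t => ?_⟩
  · convert! ((hr' t).neg.div_const 4).mul (hg₁ t) using 1
    simp only [Pi.neg_apply]
    ring
  · have h4 : g t ^ 4 = (lam ^ 2 * s t ^ 2 * Real.exp (d (X t)))⁻¹ := by
      have hsq : Real.sqrt lam ^ 4 = lam ^ 2 := by
        rw [show 4 = 2 * 2 by rfl, pow_mul, Real.sq_sqrt hlam.le]
      simp only [g]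
      rw [div_pow, hsq, ← Real.exp_nat_mul,
        show ((4 : ℕ) : ℝ) * (-(2 * Real.log (s t) + d (X t)) / 4) =
          -(Real.log (s t) + Real.log (s t) + d (X t)) by push_cast; ring,
        Real.exp_neg, Real.exp_add, Real.exp_add, Real.exp_log (hs t)]
      have := hs t
      field_simp
    rw [h4, mul_div_cancel_right₀ _ (hg0 t).ne']
    have := hs t
    simp only [hr₁, hr₂]
    field_simp
    ring

/-- The real form of the equation `σ = S[T[σ]] + p + ν`. -/
lemma residual_eq {lam : ℝ} {σ d d₁ d₂ p ν : ℝ → ℝ} (hd : ∀ x, OpT lam σ x = d x)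
    (hd₁ : ∀ x, HasDerivAt d (d₁ x) x) (hσ : ∀ x, d₂ x + 4 * lam ^ 2 * d x = σ x)
    (h : ∀ x : ℝ, (σ x : ℂ) = Sop lam (OpT lam σ) x + (p x : ℂ) + (ν x : ℂ)) (x : ℝ) :
    4 * lam ^ 2 * (Real.exp (d x) - 1) + d₂ x - d₁ x ^ 2 / 4 - p x = ν x := by
  have hx := h x
  have hderiv : deriv (OpT lam σ) x = (d₁ x : ℂ) := by
    rw [show OpT lam σ = fun x => (d x : ℂ) from funext hd]
    exact (hd₁ x).ofReal_comp.deriv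
  rw [Sop, hderiv, hd] at hx
  have hx' : σ x = d₁ x ^ 2 / 4 - 4 * lam ^ 2 * (Real.exp (d x) - d x - 1) + p x + ν x := by
    exact_mod_cast hx
  linarith [hσ x]

/-- the functions built from a nonoscillatory phase function approximate
a basis of solutions of `y'' + λ² q y = 0` with accuracy `(C/λ)·exp(−μλ)`. -/
theorem stmt_2
    (a b : ℝ) (hab : a < b)
    (q : ℝ → ℝ) (hq_smooth : ContDiff ℝ (⊤ : ℕ∞) q) (hq_pos : ∀ t : ℝ, 0 < q t)
    (X tX : ℝ → ℝ)
    (hX : ∀ t : ℝ, X t = ∫ u in a..t, Real.sqrt (q u))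
    (htX_left : Function.LeftInverse tX X) (htX_right : Function.RightInverse tX X)
    (p : ℝ → ℝ) (hp : ∀ x : ℝ, p x = 2 * schwarzian tX x)
    (hp_schwartz : IsSchwartz p)
    (Γ μ : ℝ) (hΓ : 0 < Γ) (hμ : 0 < μ)
    (hphat : ∀ ξ : ℝ, ‖FT p ξ‖ ≤ Γ * Real.exp (-μ * |ξ|)) :
    ∃ C : ℝ, 0 < C ∧
      ∀ lam : ℝ, lam > 2 * max (1 / μ) Γ →
      ∀ σ ν : ℝ → ℝ, IsSchwartz σ → IsSchwartz ν →
        (∀ x : ℝ, (σ x : ℂ) = Sop lam (OpT lam σ) x + (p x : ℂ) + (ν x : ℂ)) →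
        (∀ ξ : ℝ, |ξ| > Real.sqrt 2 * lam → FT σ ξ = 0) →
        (∀ ξ : ℝ, |ξ| ≤ Real.sqrt 2 * lam →
          ‖FT σ ξ‖ ≤ (1 + 2 * Γ / lam) * Γ * Real.exp (-μ * |ξ|)) →
        (∀ t : ℝ, |ν t| ≤ (Γ / (2 * μ)) * (1 + 4 * Γ / lam) * Real.exp (-μ * lam)) →
      ∀ δ r α u v : ℝ → ℝ,
        (∀ x : ℝ, δ x = (OpT lam σ x).re) →
        (∀ t : ℝ, r t = Real.log (q t) + δ (X t)) →
        (∀ t : ℝ, α t = lam * ∫ s in a..t, Real.exp (r s / 2)) →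
        (∀ t : ℝ, u t = Real.cos (α t) / Real.sqrt (deriv α t)) →
        (∀ t : ℝ, v t = Real.sin (α t) / Real.sqrt (deriv α t)) →
      ∃ utld vtld : ℝ → ℝ,
        ContDiffOn ℝ 2 utld (Set.Icc a b) ∧ ContDiffOn ℝ 2 vtld (Set.Icc a b) ∧
        (∀ t ∈ Set.Icc a b, deriv (deriv utld) t + lam ^ 2 * q t * utld t = 0) ∧
        (∀ t ∈ Set.Icc a b, deriv (deriv vtld) t + lam ^ 2 * q t * vtld t = 0) ∧
        (∀ c d : ℝ, (∀ t ∈ Set.Icc a b, c * utld t + d * vtld t = 0) → c = 0 ∧ d = 0) ∧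
        (∀ t ∈ Set.Icc a b, |u t - utld t| ≤ (C / lam) * Real.exp (-μ * lam)) ∧
        (∀ t ∈ Set.Icc a b, |v t - vtld t| ≤ (C / lam) * Real.exp (-μ * lam)) := by
  have hs_smooth : ContDiff ℝ (⊤ : ℕ∞) fun t => Real.sqrt (q t) :=
    hq_smooth.sqrt fun t => (hq_pos t).ne'
  set s : ℝ → ℝ := fun t => Real.sqrt (q t) with hs_def
  have hs : ∀ t, 0 < s t := fun t => Real.sqrt_pos.2 (hq_pos t)
  have hs_sq : ∀ t, s t ^ 2 = q t := fun t => Real.sq_sqrt (hq_pos t).le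
  have hs₁ : ∀ t, HasDerivAt s (deriv s t) t := fun t =>
    ((hs_smooth.differentiable (by simp)) t).hasDerivAt
  have hs₁_smooth : ContDiff ℝ (⊤ : ℕ∞) (deriv s) :=
    (contDiff_infty_iff_deriv.1 hs_smooth).2
  have hs₂ : ∀ t, HasDerivAt (deriv s) (deriv (deriv s) t) t := fun t =>
    ((hs₁_smooth.differentiable (by simp)) t).hasDerivAt
  have hXd : ∀ t, HasDerivAt X (s t) t := fun t => by
    rw [funext hX]
    exact hs_smooth.continuous.integral_hasStrictDerivAt a t |>.hasDerivAt
  have hXc : Continuous X := continuous_iff_continuousAt.2 fun t => (hXd t).continuousAt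
  have hqd : ∀ t, HasDerivAt q (deriv q t) t := fun t =>
    ((hq_smooth.differentiable (by simp)) t).hasDerivAt
  have hqc : Continuous q := hq_smooth.continuous
  have hq'c : Continuous (deriv q) := hq_smooth.continuous_deriv (by simp)
  set A : ℝ := a - 1 with hA
  set B : ℝ := b + 1 with hB
  have hAa : A < a := by linarith
  have hbB : b < B := by linarith
  have hAB : A < B := by linarith
  have hcpt : IsCompact (Set.Icc A B) := isCompact_Icc
  have hne : (Set.Icc A B).Nonempty := Set.nonempty_Icc.2 hAB.le
  obtain ⟨tm, -, htm⟩ := hcpt.exists_isMinOn hne hqc.continuousOn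
  obtain ⟨tM, -, htM⟩ := hcpt.exists_isMaxOn hne hqc.continuousOn
  obtain ⟨K', hK'⟩ := hcpt.exists_bound_of_continuousOn hq'c.continuousOn
  set m : ℝ := q tm with hm_def
  set M : ℝ := q tM with hM_def
  have hm : 0 < m := hq_pos _
  have hM : 0 < M := hq_pos _
  have hmq : ∀ t ∈ Set.Icc A B, m ≤ q t := fun t ht => htm ht
  have hMq : ∀ t ∈ Set.Icc A B, q t ≤ M := fun t ht => htM ht
  have hK'0 : 0 ≤ K' := (norm_nonneg _).trans (hK' A ⟨le_rfl, hAB.le⟩)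
  set K : ℝ := K' / m with hK_def
  have hK : 0 ≤ K := by positivity
  have hqK : ∀ t ∈ Set.Icc A B, deriv q t ≤ K * q t := by
    intro t ht
    calc deriv q t ≤ K' := (le_abs_self _).trans (hK' t ht)
      _ = K * m := by rw [hK_def, div_mul_cancel₀ _ hm.ne']
      _ ≤ K * q t := by gcongr; exact hmq t ht
  set G : ℝ := Real.sqrt (μ * Real.exp 1 / Real.sqrt m) with hG_def
  have hG : 0 < G := by positivity
  set c₀ : ℝ := M / 4 * (Γ / (2 * μ) * 3) * G with hc₀_def
  have hc₀ : 0 < c₀ := by positivity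
  set D : ℝ := (B - A) * Real.exp ((K + 1) * (B - A)) with hD_def
  have hD : 0 < D := mul_pos (by linarith) (Real.exp_pos _)
  refine ⟨c₀ * Real.sqrt (D / m), by positivity, ?_⟩
  intro lam hlam σ ν hσ _ heq hsupp hbd hν δ r α u v hδ hr hα hu hv
  have hl1 : 2 / μ < lam := by
    have := le_max_left (1 / μ) Γ
    rw [div_eq_mul_one_div]; linarith
  have hl2 : 2 * Γ < lam := by have := le_max_right (1 / μ) Γ; linarith
  have hl0 : 0 < lam := by linarith
  obtain ⟨σS, hσS⟩ := hσ
  obtain rfl : (σS : ℝ → ℝ) = σ := funext hσS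
  obtain ⟨d, d₁, d₂, hOd, hd₁, hd₂, hdσ⟩ :=
    exists_OpT_solution hl0 σS.integrable σS.continuous hsupp
  have hres := residual_eq hOd hd₁ hdσ heq
  obtain rfl : δ = d := funext fun x => by rw [hδ, hOd, Complex.ofReal_re]
  have hδ1 : ∀ x, |δ x| ≤ 1 := fun x => by
    rw [hδ]; exact abs_re_OpT_le hΓ hμ hlam hsupp hbd x
  obtain ⟨g₁, g₂, hg₁, hg₂, hg⟩ := amplitude_hasDerivAt hl0 hs hs₁ hs₂ hd₁ hd₂ hXd
  set g : ℝ → ℝ := fun t =>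
    Real.exp (-(2 * Real.log (s t) + δ (X t)) / 4) / Real.sqrt lam with hg_def
  have hg0 : ∀ t, 0 < g t := fun t => by simp only [hg_def]; positivity
  have hrs : ∀ t, r t = 2 * Real.log (s t) + δ (X t) := fun t => by
    rw [hr, ← hs_sq, Real.log_pow]; push_cast; ring
  have hδc : Continuous δ := continuous_iff_continuousAt.2 fun t => (hd₁ t).continuousAt
  have hrc : Continuous r := by
    rw [funext hr]
    exact (hqc.log fun t => (hq_pos t).ne').add (hδc.comp hXc)
  have hgα : ∀ t, 1 / g t ^ 2 = lam * Real.exp (r t / 2) := by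
    intro t
    simp only [hg_def]
    rw [div_pow, Real.sq_sqrt hl0.le, ← Real.exp_nat_mul, ← hrs,
      show ((2 : ℕ) : ℝ) * (-r t / 4) = -(r t / 2) by push_cast; ring, Real.exp_neg]
    field_simp
  have hα' : ∀ t, HasDerivAt α (1 / g t ^ 2) t := by
    intro t
    rw [hgα, funext hα]
    have hc : Continuous fun t => Real.exp (r t / 2) := by fun_prop
    exact ((hc.integral_hasStrictDerivAt a t).hasDerivAt).const_mul lam
  have hsqrt : ∀ t, Real.sqrt (deriv α t) = 1 / g t := by
    intro t
    rw [(hα' t).deriv, show 1 / g t ^ 2 = (1 / g t) ^ 2 by ring,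
      Real.sqrt_sq (by have := hg0 t; positivity)]
  have hu' : u = fun t => g t * Real.cos (α t) := funext fun t => by
    rw [hu, hsqrt, div_div_eq_mul_div, div_one, mul_comm]
  have hv' : v = fun t => g t * Real.sin (α t) := funext fun t => by
    rw [hv, hsqrt, div_div_eq_mul_div, div_one, mul_comm]
  have hphase := phase_hasDerivAt hg0 hg₁ hg₂ hα'
  rw [← hu', ← hv'] at hphase
  have hcoef : ∀ t, g₂ t / g t - 1 / g t ^ 4 = -(lam ^ 2 * q t + q t / 4 * ν (X t)) := by
    intro t
    rw [hg, hs_sq, ← hres (X t), hp, schwarzian_inverse hs hs₁ hs₂ hXd htX_left htX_right t]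
  have hgG : ∀ t ∈ Set.Icc A B, g t ≤ G := by
    intro t ht
    apply Real.le_sqrt_of_sq_le
    have h1 : g t ^ 2 = Real.exp (-(δ (X t) / 2)) / (s t * lam) := by
      rw [← one_div_one_div (g t ^ 2), hgα, hrs,
        show (2 * Real.log (s t) + δ (X t)) / 2 = Real.log (s t) + δ (X t) / 2 by ring,
        Real.exp_add, Real.exp_log (hs t), Real.exp_neg]
      have := hs t
      field_simp
    have h2 : Real.sqrt m ≤ s t := Real.sqrt_le_sqrt (hmq t ht)
    have h3 : Real.exp (-(δ (X t) / 2)) ≤ Real.exp 1 := by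
      gcongr
      have := (abs_le.1 (hδ1 (X t))).1
      linarith
    have h4 : 2 < lam * μ := (div_lt_iff₀ hμ).1 hl1
    have h5 : 0 < Real.sqrt m := Real.sqrt_pos.2 hm
    rw [h1]
    calc Real.exp (-(δ (X t) / 2)) / (s t * lam) ≤ Real.exp 1 / (Real.sqrt m * lam) := by gcongr
      _ ≤ μ * Real.exp 1 / Real.sqrt m := by
        rw [div_le_div_iff₀ (by positivity) h5]
        have : 0 < Real.exp 1 * Real.sqrt m := by positivity
        nlinarith
  have hforce : ∀ t ∈ Set.Icc A B, ∀ e : ℝ, |e| ≤ 1 →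
      |-(q t / 4 * ν (X t)) * (g t * e)| ≤ c₀ * Real.exp (-μ * lam) := by
    intro t ht e he
    have h1 : 4 * Γ / lam ≤ 2 := by rw [div_le_iff₀ hl0]; linarith
    have h2 : |ν (X t)| ≤ Γ / (2 * μ) * 3 * Real.exp (-μ * lam) := by
      refine (hν (X t)).trans ?_
      gcongr
      linarith
    have hq0 := hq_pos t
    have h3 : |g t * e| ≤ G := by
      rw [abs_mul, abs_of_pos (hg0 t)]
      exact (mul_le_of_le_one_right (hg0 t).le he).trans (hgG t ht)
    rw [abs_mul, abs_neg, abs_mul, abs_of_pos (by positivity : 0 < q t / 4)]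
    calc q t / 4 * |ν (X t)| * |g t * e|
        ≤ M / 4 * (Γ / (2 * μ) * 3 * Real.exp (-μ * lam)) * G := by
          gcongr
          exact hMq t ht
      _ = _ := by rw [hc₀_def]; ring
  obtain ⟨y, z, hyA, hzA, hyc, hzc, hyz, hye⟩ := exists_nearby_solution (k := lam)
    (f := fun t => -(q t / 4 * ν (X t)) * (g t * Real.cos (α t))) hAB hK hq_pos hqd hqK
    (fun t => (hphase t).1) (fun t => by
      convert! (hphase t).2.1 using 1
      rw [hcoef, hu']; ring)
    (fun t ht => hforce t ht _ (Real.abs_cos_le_one _))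
  obtain ⟨y', z', hyA', hzA', hyc', hzc', hyz', hye'⟩ := exists_nearby_solution (k := lam)
    (f := fun t => -(q t / 4 * ν (X t)) * (g t * Real.sin (α t))) hAB hK hq_pos hqd hqK
    (fun t => (hphase t).2.2.1) (fun t => by
      convert! (hphase t).2.2.2 using 1
      rw [hcoef, hv']; ring)
    (fun t ht => hforce t ht _ (Real.abs_sin_le_one _))
  have hQc : Continuous fun t => lam ^ 2 * q t := by fun_prop
  obtain ⟨hreg, hode⟩ := solution_regularity hAa hbB hQc hyz
  obtain ⟨hreg', hode'⟩ := solution_regularity hAa hbB hQc hyz'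
  have hest : ∀ w t : ℝ, t ∈ Set.Icc a b →
      lam ^ 2 * q t * w ^ 2 ≤ (c₀ * Real.exp (-μ * lam)) ^ 2 * D →
      |w| ≤ c₀ * Real.sqrt (D / m) / lam * Real.exp (-μ * lam) := by
    intro w t ht hw
    have h1 : m ≤ q t := hmq t ⟨hAa.le.trans ht.1, ht.2.trans hbB.le⟩
    apply abs_le_of_sq_le_sq _ (by positivity)
    rw [mul_pow, div_pow, mul_pow, Real.sq_sqrt (by positivity)]
    have h2 : lam ^ 2 * m * w ^ 2 ≤ (c₀ * Real.exp (-μ * lam)) ^ 2 * D :=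
      le_trans (by gcongr) hw
    calc w ^ 2 = lam ^ 2 * m * w ^ 2 / (lam ^ 2 * m) := by field_simp
      _ ≤ (c₀ * Real.exp (-μ * lam)) ^ 2 * D / (lam ^ 2 * m) := by gcongr
      _ = _ := by field_simp
  refine ⟨y, y', hreg, hreg', hode, hode', ?_, fun t ht => hest _ t ht (hye t ?_),
    fun t ht => hest _ t ht (hye' t ?_)⟩
  · refine solutions_linearIndependent hAa hab hbB hyc hzc hyc' hzc' hyz hyz' ?_
    rw [hyA, hzA, hyA', hzA', hu', hv']
    have h1 := Real.sin_sq_add_cos_sq (α A)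
    have h2 := hg0 A
    have h3 : g A * Real.cos (α A) * (g₁ A * Real.sin (α A) + Real.cos (α A) / g A) -
        g A * Real.sin (α A) * (g₁ A * Real.cos (α A) - Real.sin (α A) / g A) = 1 := by
      field_simp
      linarith
    simp only [h3]
    exact one_ne_zero
  · exact ⟨hAa.le.trans ht.1, ht.2.trans hbB.le⟩
  · exact ⟨hAa.le.trans ht.1, ht.2.trans hbB.le⟩

end
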